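/- The sets F_{I_1}^•, …, F_{I_m}^• form an open cover of X; that is, each F_{I_k}^• is open and X = ⋃_{k=1}^m F_{I_k}^•. -/

import Mathlib

theorem Monotone.exists_fixedPoint_of_finite {α : Type*} [LinearOrder α] [Finite α] [OrderBot α]
    {f : α → α} (hf : Monotone f) : ∃ a, f a = a := by
  obtain ⟨a, ha⟩ := (Set.toFinite {a : α | a ≤ f a}).exists_maximal ⟨⊥, bot_le⟩
  exact ⟨a, le_antisymm (ha.2 (hf ha.1) ha.1) ha.1⟩

/-- Lemma 6.5 (covering part): the shrunk footprints `F_{I_k}^•` defined by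
`F_{I_k}^• = (⋂_{i ∈ I_k} F_{i,k}) \ (⋃_{i ∉ I_k} cl(G_{i,k}))` are open and cover `X`. -/
theorem shrunk_footprints_cover
    {X : Type*} [TopologicalSpace X]
    (N m : ℕ) (hN : 0 < N) (hm : 0 < m)
    (F F' : Fin N → Set X)
    (hFopen : ∀ i, IsOpen (F i)) (hF'open : ∀ i, IsOpen (F' i))
    (hcover : (⋃ i, F' i) = Set.univ)
    (I : Fin m → Finset (Fin N))
    (hIinj : Function.Injective I)
    (hIenum : ∀ J : Finset (Fin N),
      (J.Nonempty ∧ (⋂ i ∈ J, closure (F i)).Nonempty) ↔ ∃ k : Fin m, I k = J)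
    (hIorder : ∀ k l : Fin m, I k ⊆ I l → k ≤ l)
    (G F₂ : Fin N → ℕ → Set X)
    (hGopen : ∀ i, ∀ k < m, IsOpen (G i k))
    (hF₂open : ∀ i, ∀ k < m, IsOpen (F₂ i k))
    (hF'G : ∀ i, F' i ⊆ G i 0)
    (hGF₂ : ∀ i, ∀ k < m, closure (G i k) ⊆ F₂ i k)
    (hF₂G : ∀ i, ∀ k, k + 1 < m → closure (F₂ i k) ⊆ G i (k + 1))
    (hF₂F : ∀ i, F₂ i (m - 1) ⊆ F i)
    (Fb : Fin m → Set X)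
    (hFb : ∀ k : Fin m,
      Fb k = (⋂ i ∈ I k, F₂ i (k : ℕ)) \ (⋃ i ∈ {i : Fin N | i ∉ I k}, closure (G i (k : ℕ)))) :
    (∀ k : Fin m, IsOpen (Fb k)) ∧ (⋃ k : Fin m, Fb k) = Set.univ := by
  classical
  refine ⟨fun k => ?_, Set.eq_univ_of_forall fun x => ?_⟩
  · rw [hFb k]
    refine IsOpen.sdiff ?_ ?_
    · exact isOpen_biInter_finset fun i _ => hF₂open i k k.2
    · exact (Set.toFinite _).isClosed_biUnion fun i _ => isClosed_closure
  have closure_mono : ∀ i k l, k ≤ l → l < m → closure (G i k) ⊆ closure (G i l) := by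
    intro i k l hkl
    induction l, hkl using Nat.le_induction with
    | base => exact fun _ => subset_rfl
    | succ l _ ih =>
      intro hl
      exact (ih (by lia)).trans <| (hGF₂ i l (by lia)).trans <|
        subset_closure.trans <| (hF₂G i l hl).trans subset_closure
  let A : Fin m → Finset (Fin N) := fun k => {i | x ∈ closure (G i k)}
  have mem_A : ∀ k i, i ∈ A k ↔ x ∈ closure (G i k) := fun k i => by simp [A]
  obtain ⟨j, hj⟩ : ∃ j, x ∈ F' j := Set.mem_iUnion.1 (hcover ▸ Set.mem_univ x)
  have exists_index : ∀ k, ∃ l, I l = A k := by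
    refine fun k => (hIenum _).1 ⟨⟨j, ?_⟩, x, ?_⟩
    · exact (mem_A k j).2 (closure_mono j 0 k (Nat.zero_le _) k.2 (subset_closure (hF'G j hj)))
    · refine Set.mem_iInter₂.2 fun i hi => subset_closure (hF₂F i ?_)
      have hk := k.2
      exact hGF₂ i (m - 1) (by lia)
        (closure_mono i k (m - 1) (by lia) (by lia) ((mem_A k i).1 hi))
  choose a ha using exists_index
  have a_mono : Monotone a := by
    intro k l hkl
    refine hIorder _ _ ?_
    rw [ha, ha]
    exact fun i hi => (mem_A l i).2 (closure_mono i k l hkl l.2 ((mem_A k i).1 hi))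
  have : NeZero m := ⟨hm.ne'⟩
  obtain ⟨k, hk⟩ := a_mono.exists_fixedPoint_of_finite
  have hIk : I k = A k := by rw [← ha k, hk]
  refine Set.mem_iUnion.2 ⟨k, ?_⟩
  rw [hFb k, hIk]
  refine ⟨Set.mem_iInter₂.2 fun i hi => hGF₂ i k k.2 ((mem_A k i).1 hi), fun hx => ?_⟩
  obtain ⟨i, hi, hxi⟩ := Set.mem_iUnion₂.1 hx
  exact hi ((mem_A k i).2 hxi)
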